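/- There is a universal constant C such that for every even n ≥ 2 and every t > 0, |P(W_n ≤ t) − P(Z ≤ t)| ≤ C·√(log(n)/n), where W_n takes the value W(i) := (n − 2i)(n + 2 − 2i)/(2n) with probability π(i), π(i) = (C(n,i) − C(n,i−1))/C(n, n/2) for 1 ≤ i ≤ n/2, π(0) = 1/C(n, n/2), and Z ~ Exp(1). -/

import Mathlib

open Finset Filter

/-- The probability that the spectral measure puts on eigenvalue index `i`. -/
noncomputable def piBL (n i : ℕ) : ℝ :=
  if i = 0 then 1 / (n.choose (n / 2) : ℝ)
  else ((n.choose i : ℝ) - (n.choose (i - 1) : ℝ)) / (n.choose (n / 2) : ℝ)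

/-- The rescaled eigenvalue `W(i) = (n-2i)(n+2-2i)/(2n)`. -/
noncomputable def WBL (n i : ℕ) : ℝ :=
  ((n : ℝ) - 2 * i) * ((n : ℝ) + 2 - 2 * i) / (2 * n)

/-- `P(W_n ≤ t)` for the rescaled spectral measure of the Bernoulli-Laplace chain. -/
noncomputable def PBL (n : ℕ) (t : ℝ) : ℝ :=
  ∑ i ∈ Finset.range (n / 2 + 1), if WBL n i ≤ t then piBL n i else 0


/-- The upper tail `C(2m, m-k) / C(2m, m)` of the spectral measure, as a product. -/
noncomputable def tailBL (m k : ℕ) : ℝ :=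
  ∏ i ∈ Finset.range k, ((m : ℝ) - i) / (m + i + 1)

lemma tailBL_succ (m k : ℕ) :
    tailBL m (k + 1) = tailBL m k * (((m : ℝ) - k) / (m + k + 1)) :=
  Finset.prod_range_succ _ _

lemma tailBL_eq_zero (m : ℕ) : tailBL m (m + 1) = 0 := by
  simp [tailBL_succ]

lemma choose_sub_eq_mul_tailBL {m k : ℕ} (hk : k ≤ m) :
    ((2 * m).choose (m - k) : ℝ) = (2 * m).choose m * tailBL m k := by
  induction k with
  | zero => simp [tailBL]
  | succ k ih =>
    have h := Nat.choose_succ_right_eq (2 * m) (m - (k + 1))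
    rw [show m - (k + 1) + 1 = m - k by omega,
      show 2 * m - (m - (k + 1)) = m + k + 1 by omega] at h
    have h' : ((2 * m).choose (m - k) : ℝ) * ((m : ℝ) - k)
        = (2 * m).choose (m - (k + 1)) * (m + k + 1) := by
      rw [← Nat.cast_sub (by omega : k ≤ m)]
      exact_mod_cast h
    have hpos : (0 : ℝ) < m + k + 1 := by positivity
    rw [tailBL_succ, ← mul_assoc, ← ih (by omega), ← mul_div_assoc, h',
      mul_div_cancel_right₀ _ hpos.ne']

lemma piBL_two_mul_sub {m k : ℕ} (hk : k ≤ m) :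
    piBL (2 * m) (m - k) = tailBL m k - tailBL m (k + 1) := by
  have hc : ((2 * m).choose m : ℝ) ≠ 0 := by
    exact_mod_cast (Nat.choose_pos (by omega : m ≤ 2 * m)).ne'
  unfold piBL
  rw [Nat.mul_div_cancel_left m (by norm_num)]
  split_ifs with h
  · obtain rfl : k = m := by omega
    have h1 := choose_sub_eq_mul_tailBL (le_refl k)
    rw [Nat.sub_self, Nat.choose_zero_right, Nat.cast_one] at h1
    rw [tailBL_eq_zero, sub_zero, h1, mul_div_cancel_left₀ _ hc]
  · rw [Nat.sub_sub, choose_sub_eq_mul_tailBL hk,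
      choose_sub_eq_mul_tailBL (by omega : k + 1 ≤ m), ← mul_sub, mul_div_cancel_left₀ _ hc]

lemma WBL_two_mul_sub {m k : ℕ} (hm : 0 < m) (hk : k ≤ m) :
    WBL (2 * m) (m - k) = k * (k + 1) / m := by
  have : (m : ℝ) ≠ 0 := by positivity
  unfold WBL
  push_cast [Nat.cast_sub hk]
  field_simp
  ring

/-- The distribution function of `W` in terms of its tail at the threshold index `j`. -/
lemma exists_PBL_two_mul_eq {m : ℕ} (hm : 0 < m) (t : ℝ) (ht : 0 < t) :
    ∃ j : ℕ, j + 1 ≤ m + 1 ∧ (j : ℝ) * (j + 1) ≤ m * t ∧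
      (j + 1 ≤ m → m * t < ((j : ℝ) + 1) * (j + 2)) ∧
      PBL (2 * m) t = 1 - tailBL m (j + 1) := by
  have hm' : (0 : ℝ) < m := by exact_mod_cast hm
  set p : ℕ → Prop := fun k ↦ (k : ℝ) * (k + 1) ≤ m * t with hp
  have hmono : ∀ a b : ℕ, a ≤ b → p b → p a := by
    intro a b hab hb
    have : (a : ℝ) ≤ b := by exact_mod_cast hab
    have : (a : ℝ) * (a + 1) ≤ b * (b + 1) := by gcongr
    exact this.trans hb
  classical
  have hp0 : p 0 := by simp only [hp]; push_cast; nlinarith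
  have hj : p (Nat.findGreatest p m) := Nat.findGreatest_spec (Nat.zero_le m) hp0
  have hjm : Nat.findGreatest p m ≤ m := Nat.findGreatest_le m
  have hgt : ∀ k, Nat.findGreatest p m < k → k ≤ m → ¬ p k :=
    fun k h1 h2 ↦ Nat.findGreatest_is_greatest h1 h2
  generalize Nat.findGreatest p m = j at hj hjm hgt
  refine ⟨j, by omega, hj, fun h ↦ ?_, ?_⟩
  · have := hgt (j + 1) (by omega) h
    simp only [hp, not_le] at this
    push_cast at this
    linarith
  · unfold PBL
    rw [Nat.mul_div_cancel_left m (by norm_num), ← Finset.sum_range_reflect]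
    have hterm : ∀ k ∈ Finset.range (m + 1),
        (if WBL (2 * m) (m + 1 - 1 - k) ≤ t then piBL (2 * m) (m + 1 - 1 - k) else 0)
          = if k < j + 1 then tailBL m k - tailBL m (k + 1) else 0 := by
      intro k hk
      have hk' : k ≤ m := by simpa [Nat.lt_succ_iff] using hk
      rw [Nat.add_sub_cancel, WBL_two_mul_sub hm hk', piBL_two_mul_sub hk']
      refine if_congr ?_ rfl rfl
      rw [div_le_iff₀ hm', mul_comm t]
      constructor
      · intro h
        by_contra h'
        exact hgt k (by omega) hk' h
      · intro h
        exact hmono k j (by omega) hj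
    rw [Finset.sum_congr rfl hterm, ← Finset.sum_filter,
      show (Finset.range (m + 1)).filter (· < j + 1) = Finset.range (j + 1) by
        ext k; simp only [Finset.mem_filter, Finset.mem_range]; omega,
      Finset.sum_range_sub']
    simp [tailBL]

lemma two_mul_mul_exp_neg_sq_div_le {m : ℝ} (hm : 0 < m) (x : ℝ) :
    2 * x * Real.exp (-(x ^ 2 / m)) ≤ √m := by
  have hs := Real.sqrt_pos.2 hm
  have hsq := Real.sq_sqrt hm.le
  have h1 := Real.add_one_le_exp (x ^ 2 / m)
  rw [Real.exp_neg, ← div_eq_mul_inv, div_le_iff₀ (Real.exp_pos _)]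
  refine le_trans ?_ (mul_le_mul_of_nonneg_left h1 hs.le)
  have : √m * (x ^ 2 / m + 1) - 2 * x = (x - √m) ^ 2 / √m := by
    nth_rewrite 2 [← hsq]
    field_simp
    ring
  have : 0 ≤ (x - √m) ^ 2 / √m := by positivity
  linarith

lemma two_mul_add_one_div_mul_exp_le {m : ℝ} (hm : 1 ≤ m) (x : ℝ) :
    (2 * x + 1) / m * Real.exp (-(x ^ 2 / m)) ≤ 2 / √m := by
  have hm0 : 0 < m := by linarith
  have hs : 1 ≤ √m := Real.one_le_sqrt.2 hm
  have hsq := Real.mul_self_sqrt hm0.le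
  have h1 := two_mul_mul_exp_neg_sq_div_le hm0 x
  have h2 : Real.exp (-(x ^ 2 / m)) ≤ 1 := Real.exp_le_one_iff.2 (by
    have : 0 ≤ x ^ 2 / m := by positivity
    linarith)
  have h3 : 2 / √m = 2 * √m / m := by
    rw [div_eq_div_iff (by positivity) hm0.ne']; linarith
  rw [h3, div_mul_eq_mul_div]
  exact div_le_div_of_nonneg_right (by linarith) hm0.le

lemma abs_sub_exp_neg_le_sq {m k : ℝ} (hm : 0 < m) (hk : 0 ≤ k) :
    |(m - k) / (m + k + 1) - Real.exp (-((2 * k + 1) / m))| ≤ ((2 * k + 1) / m) ^ 2 := by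
  set u := (2 * k + 1) / m with hu
  have hu0 : 0 ≤ u := by positivity
  have h1 := Real.one_sub_le_exp_neg u
  have h2 : Real.exp (-u) ≤ 1 - u + u ^ 2 := by
    have h3 := Real.add_one_le_exp u
    rw [Real.exp_neg, inv_le_iff_one_le_mul₀ (Real.exp_pos u)]
    have : 0 ≤ 1 - u + u ^ 2 := by nlinarith [sq_nonneg (u - 1)]
    nlinarith [mul_le_mul_of_nonneg_left h3 this, pow_nonneg hu0 3]
  have h4 : (m - k) / (m + k + 1) - (1 - u) = u * ((k + 1) / (m + k + 1)) := by
    rw [hu]; field_simp; ring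
  have h5 : (k + 1) / (m + k + 1) ≤ u := by
    rw [hu, div_le_div_iff₀ (by positivity) hm]
    nlinarith
  have h6 : 0 ≤ u * ((k + 1) / (m + k + 1)) := by positivity
  have h7 := mul_le_mul_of_nonneg_left h5 hu0
  rw [abs_le]
  constructor <;> nlinarith

/-- The tail is uniformly close to the Gaussian profile `exp (-k² / m)`. -/
lemma abs_tailBL_sub_exp_le {m : ℕ} (hm : 0 < m) {k : ℕ} (hk : k ≤ m + 1) :
    |tailBL m k - Real.exp (-((k : ℝ) ^ 2 / m))| ≤ 6 / √m := by
  have hm1 : (1 : ℝ) ≤ m := by exact_mod_cast hm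
  have hm0 : (0 : ℝ) < m := by linarith
  induction k with
  | zero => simp [tailBL]; positivity
  | succ k ih =>
    have ih := ih (by omega)
    have hkm : (k : ℝ) ≤ m := by exact_mod_cast (by omega : k ≤ m)
    have hk0 : (0 : ℝ) ≤ k := k.cast_nonneg
    have hE : Real.exp (-(((k + 1 : ℕ) : ℝ) ^ 2 / m))
        = Real.exp (-((k : ℝ) ^ 2 / m)) * Real.exp (-((2 * k + 1) / m)) := by
      rw [← Real.exp_add]; congr 1; push_cast; field_simp; ring
    rw [hE, tailBL_succ]
    have hre := abs_sub_exp_neg_le_sq hm0 hk0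
    have huE := two_mul_add_one_div_mul_exp_le hm1 k
    have hr0 : 0 ≤ ((m : ℝ) - k) / (m + k + 1) := div_nonneg (by linarith) (by positivity)
    have hr1 : ((m : ℝ) - k) / (m + k + 1) ≤ 1 - (2 * k + 1) / m / 3 := by
      rw [div_div, le_sub_iff_add_le, div_add_div _ _ (by positivity) (by positivity),
        div_le_one (by positivity)]
      nlinarith
    set r := ((m : ℝ) - k) / (m + k + 1)
    set u := (2 * (k : ℝ) + 1) / m
    set E := Real.exp (-((k : ℝ) ^ 2 / m))
    have hE0 : 0 < E := Real.exp_pos _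
    have hu0 : 0 ≤ u := by positivity
    set s := √(m : ℝ)
    calc |tailBL m k * r - E * Real.exp (-u)|
        = |(tailBL m k - E) * r + E * (r - Real.exp (-u))| := by congr 1; ring
      _ ≤ |tailBL m k - E| * r + E * |r - Real.exp (-u)| := by
        refine (abs_add_le _ _).trans_eq ?_
        rw [abs_mul, abs_mul, abs_of_nonneg hr0, abs_of_pos hE0]
      _ ≤ 6 / s * (1 - u / 3) + E * u ^ 2 := by gcongr
      _ = 6 / s * (1 - u / 3) + u * (u * E) := by ring
      _ ≤ 6 / s * (1 - u / 3) + u * (2 / s) := by gcongr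
      _ = 6 / s := by ring

lemma abs_exp_neg_sub_exp_neg_le {a b c d : ℝ} (ha : c ≤ a) (hb : c ≤ b) (hd : |a - b| ≤ d) :
    |Real.exp (-a) - Real.exp (-b)| ≤ d * Real.exp (-c) := by
  wlog hab : a ≤ b generalizing a b
  · rw [abs_sub_comm]
    exact this hb ha (by rwa [abs_sub_comm]) (by linarith)
  rw [abs_of_nonneg (by
    have := Real.exp_le_exp.2 (neg_le_neg hab)
    linarith)]
  rw [abs_of_nonpos (by linarith)] at hd
  have h1 : Real.exp (-b) = Real.exp (-a) * Real.exp (-(b - a)) := by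
    rw [← Real.exp_add]; ring_nf
  have h2 := Real.one_sub_le_exp_neg (b - a)
  have h3 : Real.exp (-a) ≤ Real.exp (-c) := Real.exp_le_exp.2 (by linarith)
  calc Real.exp (-a) - Real.exp (-b) = (1 - Real.exp (-(b - a))) * Real.exp (-a) := by
        rw [h1]; ring
    _ ≤ d * Real.exp (-c) := by
        gcongr
        · linarith
        · linarith

/-- The distribution function of `W` is within `O(1 / √m)` of the exponential one. -/
lemma abs_PBL_two_mul_sub_le {m : ℕ} (hm : 0 < m) {t : ℝ} (ht : 0 < t) :
    |PBL (2 * m) t - (1 - Real.exp (-t))| ≤ 8 / √m := by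
  obtain ⟨j, hjm, hlow, hup, hP⟩ := exists_PBL_two_mul_eq hm t ht
  have hm1 : (1 : ℝ) ≤ m := by exact_mod_cast hm
  have hm0 : (0 : ℝ) < m := by linarith
  have hj0 : (0 : ℝ) ≤ j := j.cast_nonneg
  have hs : 1 ≤ √(m : ℝ) := Real.one_le_sqrt.2 hm1
  have hsq := Real.mul_self_sqrt hm0.le
  rw [hP]
  by_cases hj : j + 1 ≤ m
  · have hup := hup hj
    have h1 := abs_tailBL_sub_exp_le hm hjm
    have h2 := two_mul_add_one_div_mul_exp_le hm1 j
    have h3 : |t - ((j + 1 : ℕ) : ℝ) ^ 2 / m| ≤ (2 * j + 1) / m := by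
      rw [show t - ((j + 1 : ℕ) : ℝ) ^ 2 / m = (m * t - ((j : ℝ) + 1) ^ 2) / m by
        push_cast; field_simp, abs_div, abs_of_pos hm0]
      gcongr
      rw [abs_le]
      constructor <;> nlinarith
    have h4 := abs_exp_neg_sub_exp_neg_le (c := (j : ℝ) ^ 2 / m)
      (by rw [div_le_iff₀ hm0]; nlinarith) (by push_cast; gcongr; linarith) h3
    have h5 : (8 : ℝ) / √m = 6 / √m + 2 / √m := by ring
    rw [abs_le] at *
    constructor <;> linarith [h1.1, h1.2, h4.1, h4.2]
  · obtain rfl : j = m := by omega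
    have h1 : (j : ℝ) + 1 ≤ t := by nlinarith
    have h2 := Real.add_one_le_exp t
    rw [tailBL_eq_zero, show (1 : ℝ) - 0 - (1 - Real.exp (-t)) = Real.exp (-t) by ring,
      abs_of_pos (Real.exp_pos _), Real.exp_neg, ← one_div]
    exact div_le_div₀ (by norm_num) (by norm_num) (by linarith) (by nlinarith)

lemma one_div_two_mul_sqrt_le {m : ℕ} (hm : 0 < m) :
    1 / (2 * √(m : ℝ)) ≤ √(Real.log ((2 * m : ℕ) : ℝ) / ((2 * m : ℕ) : ℝ)) := by
  have hm1 : (1 : ℝ) ≤ m := by exact_mod_cast hm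
  have hm0 : (0 : ℝ) < m := by linarith
  have hlog : 1 / 2 ≤ Real.log ((2 * m : ℕ) : ℝ) := by
    have := Real.log_le_log (by norm_num : (0 : ℝ) < 2)
      (by push_cast; linarith : (2 : ℝ) ≤ ((2 * m : ℕ) : ℝ))
    linarith [Real.log_two_gt_d9]
  apply Real.le_sqrt_of_sq_le
  rw [div_pow, mul_pow, Real.sq_sqrt hm0.le]
  push_cast at *
  rw [div_le_div_iff₀ (by positivity) (by positivity)]
  nlinarith

/-- Proposition 4.4: weaker bound `C√(log n / n)` via the concentration inequality. -/
theorem bernoulli_laplace_log_bound :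
    ∃ C : ℝ, ∀ n : ℕ, Even n → 2 ≤ n → ∀ t : ℝ, 0 < t →
      |PBL n t - (1 - Real.exp (-t))| ≤ C * Real.sqrt (Real.log n / n) := by
  refine ⟨16, fun n hn hn2 t ht ↦ ?_⟩
  obtain ⟨m, rfl⟩ := hn.two_dvd
  have hm : 0 < m := by omega
  calc |PBL (2 * m) t - (1 - Real.exp (-t))| ≤ 8 / √(m : ℝ) := abs_PBL_two_mul_sub_le hm ht
    _ = 16 * (1 / (2 * √(m : ℝ))) := by ring
    _ ≤ _ := mul_le_mul_of_nonneg_left (one_div_two_mul_sqrt_le hm) (by norm_num)
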